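/- Let p ∈ [1,∞), L, r ∈ (0,∞), let (E,δ) be a nonempty separable metric space, let (Ω,𝓕,ℙ) be a probability space, let Z_x : Ω → ℝ, x ∈ E, be random variables, and assume for all x, y ∈ E that 𝔼[|Z_x|] < ∞ and |Z_x − Z_y| ≤ L·δ(x,y) (pointwise on Ω). Then (𝔼[sup_{x ∈ E} |Z_x − 𝔼[Z_x]|^p])^{1/p} ≤ (𝒞_{(E,δ),r})^{1/p} · (2·L·r + sup_{x ∈ E} (𝔼[|Z_x − 𝔼[Z_x]|^p])^{1/p}). -/

import Mathlib

open MeasureTheory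
open scoped ENNReal

/-- The covering number of a set `E` with respect to a distance function `δ` and radius `r`. -/
noncomputable def coveringNumber {E : Type*} (δ : E → E → ℝ) (r : ℝ) : ℕ∞ :=
  ⨅ (A : Finset E) (_ : ∀ x : E, ∃ a ∈ A, δ a x ≤ r), (A.card : ℕ∞)

theorem exists_cover_card_eq_coveringNumber {E : Type*} {δ : E → E → ℝ} {r : ℝ}
    (h : coveringNumber δ r ≠ ⊤) :
    ∃ A : Finset E, (∀ x : E, ∃ a ∈ A, δ a x ≤ r) ∧ (A.card : ℕ∞) = coveringNumber δ r := by
  have hsub : coveringNumber δ r =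
      ⨅ A : {A : Finset E // ∀ x : E, ∃ a ∈ A, δ a x ≤ r}, (A.1.card : ℕ∞) := by
    rw [coveringNumber, iInf_subtype]
  rcases isEmpty_or_nonempty {A : Finset E // ∀ x : E, ∃ a ∈ A, δ a x ≤ r} with hE | hE
  · exact absurd (by rw [hsub, iInf_of_empty]) h
  · obtain ⟨A, hA⟩ := ciInf_mem
      fun A : {A : Finset E // ∀ x : E, ∃ a ∈ A, δ a x ≤ r} => (A.1.card : ℕ∞)
    exact ⟨A.1, A.2, hA.trans hsub.symm⟩

theorem abs_sub_integral_le_of_abs_sub_le {Ω : Type*} [MeasurableSpace Ω] {P : Measure Ω}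
    [IsProbabilityMeasure P] {X Y : Ω → ℝ} (hX : Integrable X P) (hY : Integrable Y P) {c : ℝ}
    (h : ∀ ω, |X ω - Y ω| ≤ c) (ω : Ω) :
    |X ω - ∫ ω', X ω' ∂P| ≤ 2 * c + |Y ω - ∫ ω', Y ω' ∂P| := by
  have hmean : |∫ ω', X ω' ∂P - ∫ ω', Y ω' ∂P| ≤ c := by
    rw [← integral_sub hX hY]
    simpa using norm_integral_le_of_norm_le_const (μ := P) (f := fun ω => X ω - Y ω)
      (Filter.Eventually.of_forall h)
  have hω := h ω
  have htri := abs_add_three (X ω - Y ω) (Y ω - ∫ ω', Y ω' ∂P)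
    (-(∫ ω', X ω' ∂P - ∫ ω', Y ω' ∂P))
  rw [abs_neg] at htri
  calc |X ω - ∫ ω', X ω' ∂P|
      = |X ω - Y ω + (Y ω - ∫ ω', Y ω' ∂P) + -(∫ ω', X ω' ∂P - ∫ ω', Y ω' ∂P)| := by
        congr 1; ring
    _ ≤ _ := by linarith

theorem lintegral_const_add_rpow_le {Ω : Type*} [MeasurableSpace Ω] {P : Measure Ω}
    [IsProbabilityMeasure P] {f : Ω → ℝ≥0∞} (hf : Measurable f) {p : ℝ} (hp : 1 ≤ p)
    (c : ℝ≥0∞) :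
    ∫⁻ ω, (c + f ω) ^ p ∂P ≤ (c + (∫⁻ ω, f ω ^ p ∂P) ^ (1 / p)) ^ p := by
  have hp0 : 0 < p := by linarith
  have h := ENNReal.lintegral_Lp_add_le (μ := P) (f := fun _ => c) aemeasurable_const
    hf.aemeasurable hp
  rw [lintegral_const, measure_univ, mul_one, one_div, ENNReal.rpow_rpow_inv hp0.ne'] at h
  rw [one_div, ← ENNReal.rpow_inv_le_iff hp0]
  exact h

theorem stmt6 {E : Type*} [MetricSpace E] [TopologicalSpace.SeparableSpace E] [Nonempty E]
    (p L r : ℝ) (hp : 1 ≤ p) (hL : 0 < L) (hr : 0 < r)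
    {Ω : Type*} [MeasurableSpace Ω] (P : Measure Ω) [IsProbabilityMeasure P]
    (Z : E → Ω → ℝ) (hmeas : ∀ x, Measurable (Z x)) (hint : ∀ x, Integrable (Z x) P)
    (hlip : ∀ (ω : Ω) (x y : E), |Z x ω - Z y ω| ≤ L * dist x y) :
    (∫⁻ ω, (⨆ x : E, ENNReal.ofReal |Z x ω - ∫ ω', Z x ω' ∂P|) ^ p ∂P) ^ (1 / p) ≤
      (coveringNumber (fun x y : E => dist x y) r : ℝ≥0∞) ^ (1 / p) *
        (ENNReal.ofReal (2 * L * r) +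
          ⨆ x : E, (∫⁻ ω, (ENNReal.ofReal |Z x ω - ∫ ω', Z x ω' ∂P|) ^ p ∂P) ^ (1 / p)) := by
  have hp0 : 0 < p := by linarith
  by_cases htop : coveringNumber (fun x y : E => dist x y) r = ⊤
  · have hc : ENNReal.ofReal (2 * L * r) ≠ 0 := by
      rw [ne_eq, ENNReal.ofReal_eq_zero, not_le]; positivity
    rw [htop, ENat.toENNReal_top, ENNReal.top_rpow_of_pos (by positivity),
      ENNReal.top_mul (by simp [hc])]
    exact le_top
  obtain ⟨A, hA, hcard⟩ := exists_cover_card_eq_coveringNumber htop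
  rw [← hcard, ENat.toENNReal_coe]
  set c := ENNReal.ofReal (2 * L * r)
  set f : E → Ω → ℝ≥0∞ := fun x ω => ENNReal.ofReal |Z x ω - ∫ ω', Z x ω' ∂P|
  have hf : ∀ x, Measurable (f x) := fun x =>
    ENNReal.measurable_ofReal.comp ((hmeas x).sub_const _).abs
  set S := ⨆ x : E, (∫⁻ ω, f x ω ^ p ∂P) ^ (1 / p)
  have hcover : ∀ ω x, ∃ a ∈ A, f x ω ≤ c + f a ω := by
    intro ω x
    obtain ⟨a, ha, hax⟩ := hA x
    refine ⟨a, ha, ?_⟩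
    have hxa : ∀ ω, |Z x ω - Z a ω| ≤ L * r := fun ω =>
      (hlip ω x a).trans (by rw [dist_comm]; gcongr)
    rw [← ENNReal.ofReal_add (by positivity) (abs_nonneg _), mul_assoc]
    exact ENNReal.ofReal_le_ofReal
      (abs_sub_integral_le_of_abs_sub_le (hint x) (hint a) hxa ω)
  have hsup : ∀ ω, (⨆ x, f x ω) ^ p ≤ ∑ a ∈ A, (c + f a ω) ^ p := by
    intro ω
    rw [← ENNReal.le_rpow_inv_iff hp0]
    refine iSup_le fun x => ?_
    obtain ⟨a, ha, hxa⟩ := hcover ω x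
    rw [ENNReal.le_rpow_inv_iff hp0]
    exact (ENNReal.rpow_le_rpow hxa hp0.le).trans
      (Finset.single_le_sum (f := fun a => (c + f a ω) ^ p) (fun _ _ => zero_le) ha)
  have hbound : ∫⁻ ω, (⨆ x, f x ω) ^ p ∂P ≤ A.card * (c + S) ^ p :=
    calc ∫⁻ ω, (⨆ x, f x ω) ^ p ∂P
        ≤ ∫⁻ ω, ∑ a ∈ A, (c + f a ω) ^ p ∂P := lintegral_mono hsup
      _ = ∑ a ∈ A, ∫⁻ ω, (c + f a ω) ^ p ∂P :=
        lintegral_finsetSum _ fun a _ => ((hf a).const_add c).pow_const p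
      _ ≤ ∑ _a ∈ A, (c + S) ^ p := Finset.sum_le_sum fun a _ =>
        (lintegral_const_add_rpow_le (hf a) hp c).trans <| ENNReal.rpow_le_rpow
          (by gcongr; exact le_iSup (fun x => (∫⁻ ω, f x ω ^ p ∂P) ^ (1 / p)) a) hp0.le
      _ = A.card * (c + S) ^ p := by rw [Finset.sum_const, nsmul_eq_mul]
  calc (∫⁻ ω, (⨆ x, f x ω) ^ p ∂P) ^ (1 / p)
      ≤ (A.card * (c + S) ^ p) ^ (1 / p) := ENNReal.rpow_le_rpow hbound (by positivity)
    _ = (A.card : ℝ≥0∞) ^ (1 / p) * (c + S) := by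
      rw [ENNReal.mul_rpow_of_nonneg _ _ (by positivity), one_div,
        ENNReal.rpow_rpow_inv hp0.ne']
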